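/- arXiv:1812.08734 — 3 statements merged into one kernel-verified Lean document; each statement's English description precedes it below -/
import Mathlib

section
/- Let Ω ⊂ S² be a finite set with Ω = −Ω, let λ ∈ ℕ be such that λk ∈ ℤ³ for every k ∈ Ω, and let c_k ∈ ℂ (k ∈ Ω) satisfy c_k = conj(c_{−k}). Define V(x) := Σ_{k∈Ω} λ^{−1} c_k e^{iλ k·x} for x ∈ 𝕋³. Then: (i) V is real-valued; (ii) ΔV = −λ² V; (iii) there exists a smooth vector field Q : 𝕋³ → ℝ³ such that ∇̄ · (∇V ⊗ ∇̄⊥V) = curl Q, with ‖Q‖_{C⁰} ≤ C ‖∇V‖_{C⁰}² and ‖curl Q‖_{C⁰} ≤ C λ ‖∇V‖_{C⁰}² for a universal constant C; (iv) the average over 𝕋³ of the matrix field ∇V ⊗ ∇̄⊥V equals Σ_{k∈Ω} |c_k|² k ⊗ k̄⊥. -/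
open Real MeasureTheory

noncomputable section

/-- Partial derivative of a scalar function in the `i`-th coordinate direction. -/
def pd3 (i : Fin 3) (f : (Fin 3 → ℝ) → ℝ) (x : Fin 3 → ℝ) : ℝ :=
  fderiv ℝ f x (Pi.single i 1)

/-- The fundamental domain `[0,2π]³` of the torus `𝕋³ = (ℝ/2πℤ)³`. -/
def box3 : Set (Fin 3 → ℝ) := Set.Icc 0 (fun _ => 2 * Real.pi)

/-- `k̄⊥ = (−k₂, k₁, 0)` for `k = (k₁,k₂,k₃)`. -/
def kperp (k : Fin 3 → ℝ) : Fin 3 → ℝ := ![-(k 1), k 0, 0]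

/-- `V(x) = Σ_{k∈Ω} λ⁻¹ c_k e^{iλ k·x}`. -/
def Vc (Ω : Finset (Fin 3 → ℝ)) (c : (Fin 3 → ℝ) → ℂ) (lam : ℕ) (x : Fin 3 → ℝ) : ℂ :=
  ∑ k ∈ Ω, (lam : ℂ)⁻¹ * c k *
    Complex.exp (Complex.I * Complex.ofReal ((lam : ℝ) * ∑ i, k i * x i))

/-- The real part of `V`. -/
def Vr (Ω : Finset (Fin 3 → ℝ)) (c : (Fin 3 → ℝ) → ℂ) (lam : ℕ) (x : Fin 3 → ℝ) : ℝ :=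
  (Vc Ω c lam x).re

/-- The stratified velocity field `∇̄⊥V = (−∂_y V, ∂ₓ V, 0)`. -/
def gperp (V : (Fin 3 → ℝ) → ℝ) (x : Fin 3 → ℝ) : Fin 3 → ℝ :=
  ![-(pd3 1 V x), pd3 0 V x, 0]

/-- The `i`-th row of `∇̄ · (∇V ⊗ ∇̄⊥V)` (horizontal divergence, row by row). -/
def divbarRow (V : (Fin 3 → ℝ) → ℝ) (x : Fin 3 → ℝ) (i : Fin 3) : ℝ :=
  pd3 0 (fun y => pd3 i V y * gperp V y 0) x +
    pd3 1 (fun y => pd3 i V y * gperp V y 1) x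

/-- The three-dimensional curl of a vector field. -/
def curl3 (Q : (Fin 3 → ℝ) → Fin 3 → ℝ) (x : Fin 3 → ℝ) : Fin 3 → ℝ :=
  ![pd3 1 (fun y => Q y 2) x - pd3 2 (fun y => Q y 1) x,
    pd3 2 (fun y => Q y 0) x - pd3 0 (fun y => Q y 2) x,
    pd3 0 (fun y => Q y 1) x - pd3 1 (fun y => Q y 0) x]

/-- The trigonometric sum `Σ_{k∈Ω} a_k e^{iλ k·x}`. -/
def trigSum (Ω : Finset (Fin 3 → ℝ)) (lam : ℕ) (a : (Fin 3 → ℝ) → ℂ) (x : Fin 3 → ℝ) : ℂ :=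
  ∑ k ∈ Ω, a k * Complex.exp (Complex.I * Complex.ofReal ((lam : ℝ) * ∑ i, k i * x i))

/-- The coefficients of the `i`-th partial derivative of `trigSum Ω lam a`. -/
def derivCoeff (lam : ℕ) (i : Fin 3) (a : (Fin 3 → ℝ) → ℂ) (k : Fin 3 → ℝ) : ℂ :=
  Complex.I * ((lam * k i : ℝ) : ℂ) * a k

theorem contDiff_trigSum (Ω : Finset (Fin 3 → ℝ)) (lam : ℕ) (a : (Fin 3 → ℝ) → ℂ)
    {n : WithTop ℕ∞} : ContDiff ℝ n (trigSum Ω lam a) := by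
  unfold trigSum
  refine ContDiff.sum fun k _ => contDiff_const.mul (ContDiff.cexp (contDiff_const.mul ?_))
  have h : ContDiff ℝ n fun x : Fin 3 → ℝ => (lam : ℝ) * ∑ i, k i * x i :=
    contDiff_const.mul (by fun_prop)
  exact Complex.ofRealCLM.contDiff.comp h

theorem contDiff_re_trigSum (Ω : Finset (Fin 3 → ℝ)) (lam : ℕ) (a : (Fin 3 → ℝ) → ℂ)
    {n : WithTop ℕ∞} : ContDiff ℝ n fun x => (trigSum Ω lam a x).re :=
  Complex.reCLM.contDiff.comp (contDiff_trigSum Ω lam a)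

theorem hasDerivAt_trigSum (Ω : Finset (Fin 3 → ℝ)) (lam : ℕ) (a : (Fin 3 → ℝ) → ℂ)
    (i : Fin 3) (x : Fin 3 → ℝ) :
    HasDerivAt (fun t : ℝ => trigSum Ω lam a (x + t • (Pi.single i (1 : ℝ) : Fin 3 → ℝ)))
      (trigSum Ω lam (derivCoeff lam i a) x) 0 := by
  unfold trigSum
  refine HasDerivAt.fun_sum fun k _ => ?_
  have h : ∀ t : ℝ, (lam : ℝ) * ∑ j, k j * (x + t • (Pi.single i (1 : ℝ) : Fin 3 → ℝ)) j =
      lam * ∑ j, k j * x j + t * (lam * k i) := by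
    intro t
    simp [mul_add, Finset.sum_add_distrib, Pi.single_apply]
    ring
  simp only [h]
  have h1 : HasDerivAt (fun t : ℝ => (lam : ℝ) * ∑ j, k j * x j + t * (lam * k i))
      (lam * k i) 0 := by
    simpa using ((hasDerivAt_id (0 : ℝ)).mul_const ((lam : ℝ) * k i)).const_add
      ((lam : ℝ) * ∑ j, k j * x j)
  convert! ((h1.ofReal_comp.const_mul Complex.I).cexp.const_mul (a k)) using 1
  simp only [derivCoeff, zero_mul, add_zero]
  ring

theorem pd3_re_trigSum (Ω : Finset (Fin 3 → ℝ)) (lam : ℕ) (a : (Fin 3 → ℝ) → ℂ) (i : Fin 3) :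
    pd3 i (fun x => (trigSum Ω lam a x).re) =
      fun x => (trigSum Ω lam (derivCoeff lam i a) x).re := by
  funext x
  have hd : DifferentiableAt ℝ (fun x => (trigSum Ω lam a x).re) x :=
    ((contDiff_re_trigSum Ω lam a (n := 1)).differentiable (by simp)).differentiableAt
  have h1 := hd.hasFDerivAt.hasLineDerivAt (Pi.single i (1 : ℝ))
  have h2 := (Complex.reCLM.hasFDerivAt.comp_hasDerivAt (0 : ℝ)
    (hasDerivAt_trigSum Ω lam a i x))
  exact h1.unique h2

theorem conj_trigSum (Ω : Finset (Fin 3 → ℝ)) (lam : ℕ) (a : (Fin 3 → ℝ) → ℂ)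
    (x : Fin 3 → ℝ) :
    starRingEnd ℂ (trigSum Ω lam a x) = ∑ k ∈ Ω, starRingEnd ℂ (a k) *
      Complex.exp (-(Complex.I * Complex.ofReal ((lam : ℝ) * ∑ i, k i * x i))) := by
  simp only [trigSum, map_sum, map_mul, ← Complex.exp_conj, Complex.conj_I, Complex.conj_ofReal,
    neg_mul]

theorem trigSum_im_eq_zero {Ω : Finset (Fin 3 → ℝ)} (lam : ℕ) {a : (Fin 3 → ℝ) → ℂ}
    (hΩ : ∀ k : Fin 3 → ℝ, k ∈ Ω ↔ -k ∈ Ω) (ha : ∀ k ∈ Ω, a (-k) = starRingEnd ℂ (a k))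
    (x : Fin 3 → ℝ) : (trigSum Ω lam a x).im = 0 := by
  rw [← Complex.conj_eq_iff_im, conj_trigSum]
  refine Finset.sum_bij' (fun k _ => -k) (fun k _ => -k) (fun k hk => (hΩ k).1 hk)
    (fun k hk => (hΩ k).1 hk) (fun k _ => neg_neg k) (fun k _ => neg_neg k) fun k hk => ?_
  rw [ha k hk]
  congr 2
  simp [Finset.sum_neg_distrib]

theorem derivCoeff_neg {Ω : Finset (Fin 3 → ℝ)} (lam : ℕ) (i : Fin 3) {a : (Fin 3 → ℝ) → ℂ}
    (ha : ∀ k ∈ Ω, a (-k) = starRingEnd ℂ (a k)) :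
    ∀ k ∈ Ω, derivCoeff lam i a (-k) = starRingEnd ℂ (derivCoeff lam i a k) := by
  intro k hk
  simp [derivCoeff, ha k hk]

theorem hasSum_cos_sub_cos {s : ℝ} (hs : |s| ≤ 1) :
    HasSum (fun n : ℕ => 1 / (n : ℝ) ^ 2 *
      (Real.cos (2 * π * n * ((1 + s) / 4 + 1 / 2)) - Real.cos (2 * π * n * ((1 + s) / 4))))
      (π ^ 2 / 4 * s) := by
  obtain ⟨h1, h2⟩ := abs_le.1 hs
  have e1 := hasSum_one_div_nat_pow_mul_cos one_ne_zero (x := (1 + s) / 4 + 1 / 2)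
    ⟨by linarith, by linarith⟩
  have e2 := hasSum_one_div_nat_pow_mul_cos one_ne_zero (x := (1 + s) / 4)
    ⟨by linarith, by linarith⟩
  convert! e1.sub e2 using 1
  · funext n
    simp only [mul_one]
    ring
  · simp [Polynomial.bernoulli_def, Finset.sum_range_succ, bernoulli_one, bernoulli_two]
    ring

theorem trigSum_add_single (Ω : Finset (Fin 3 → ℝ)) {lam : ℕ} (hlam : 0 < lam)
    (a : (Fin 3 → ℝ) → ℂ) (i : Fin 3) (t : ℝ) (x : Fin 3 → ℝ) :
    trigSum Ω lam a (x + Pi.single i (t / lam)) =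
      trigSum Ω lam (fun k => a k * Complex.exp (Complex.I * ((t * k i : ℝ) : ℂ))) x := by
  have hl : (lam : ℝ) ≠ 0 := by positivity
  refine Finset.sum_congr rfl fun k _ => ?_
  rw [mul_assoc, ← Complex.exp_add, ← mul_add, ← Complex.ofReal_add]
  congr 4
  simp [mul_add, Finset.sum_add_distrib, Pi.single_apply]
  field_simp
  ring

theorem norm_trigSum_cos_le (Ω : Finset (Fin 3 → ℝ)) {lam : ℕ} (hlam : 0 < lam)
    (a : (Fin 3 → ℝ) → ℂ) (i : Fin 3) {M : ℝ} (hM : ∀ x, ‖trigSum Ω lam a x‖ ≤ M)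
    (t θ : ℝ) (x : Fin 3 → ℝ) :
    ‖trigSum Ω lam (fun k => a k * ((Real.cos (θ + t * k i) : ℝ) : ℂ)) x‖ ≤ M := by
  have h : trigSum Ω lam (fun k => a k * ((Real.cos (θ + t * k i) : ℝ) : ℂ)) x =
      (Complex.exp (θ * Complex.I) * trigSum Ω lam a (x + Pi.single i (t / lam)) +
        Complex.exp ((-θ : ℝ) * Complex.I) *
          trigSum Ω lam a (x + Pi.single i (-t / lam))) / 2 := by
    rw [trigSum_add_single Ω hlam, trigSum_add_single Ω hlam]
    unfold trigSum
    rw [Finset.mul_sum, Finset.mul_sum, ← Finset.sum_add_distrib, Finset.sum_div]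
    refine Finset.sum_congr rfl fun k _ => ?_
    have h1 : ((Real.cos (θ + t * k i) : ℝ) : ℂ) =
        (Complex.exp (θ * Complex.I) * Complex.exp (Complex.I * ((t * k i : ℝ) : ℂ)) +
        Complex.exp ((-θ : ℝ) * Complex.I) *
          Complex.exp (Complex.I * ((-t * k i : ℝ) : ℂ))) / 2 := by
      rw [← Complex.exp_add, ← Complex.exp_add, Complex.ofReal_cos, Complex.cos]
      congr 3 <;> push_cast <;> ring
    dsimp only
    rw [h1]
    ring
  rw [h, norm_div, Complex.norm_ofNat, div_le_iff₀ two_pos]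
  refine (norm_add_le _ _).trans ?_
  rw [norm_mul, norm_mul, Complex.norm_exp_ofReal_mul_I, Complex.norm_exp_ofReal_mul_I]
  linarith [hM (x + Pi.single i (t / lam)), hM (x + Pi.single i (-t / lam))]

/-- **Bernstein's inequality** for trigonometric sums with frequencies in the cube `[-λ, λ]³`. -/
theorem norm_trigSum_derivCoeff_le (Ω : Finset (Fin 3 → ℝ)) {lam : ℕ} (hlam : 0 < lam)
    (a : (Fin 3 → ℝ) → ℂ) (i : Fin 3) (hk : ∀ k ∈ Ω, |k i| ≤ 1) {M : ℝ}
    (hM : ∀ x, ‖trigSum Ω lam a x‖ ≤ M) (x : Fin 3 → ℝ) :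
    ‖trigSum Ω lam (derivCoeff lam i a) x‖ ≤ 4 / 3 * lam * M := by
  set b : (Fin 3 → ℝ) → ℂ := fun k => a k * ((π ^ 2 / 4 * k i : ℝ) : ℂ)
  have hsum : HasSum (fun n : ℕ => ((1 / (n : ℝ) ^ 2 : ℝ) : ℂ) *
      (trigSum Ω lam
          (fun k => a k * ((Real.cos (3 * π * n / 2 + π * n / 2 * k i) : ℝ) : ℂ)) x -
        trigSum Ω lam
          (fun k => a k * ((Real.cos (π * n / 2 + π * n / 2 * k i) : ℝ) : ℂ)) x))
      (trigSum Ω lam b x) := by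
    have := hasSum_sum fun k (hk' : k ∈ Ω) =>
      ((Complex.hasSum_ofReal.2 (hasSum_cos_sub_cos (hk k hk'))).mul_left (a k)).mul_right
        (Complex.exp (Complex.I * Complex.ofReal ((lam : ℝ) * ∑ i, k i * x i)))
    convert! this using 1
    funext n
    unfold trigSum
    rw [← Finset.sum_sub_distrib, Finset.mul_sum]
    refine Finset.sum_congr rfl fun k _ => ?_
    rw [show 2 * π * n * ((1 + k i) / 4 + 1 / 2) = 3 * π * n / 2 + π * n / 2 * k i by ring,
      show 2 * π * n * ((1 + k i) / 4) = π * n / 2 + π * n / 2 * k i by ring]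
    push_cast
    ring
  have hb : ‖trigSum Ω lam b x‖ ≤ π ^ 2 / 6 * (2 * M) := by
    refine hsum.norm_le_of_bounded (hasSum_zeta_two.mul_right (2 * M)) fun n => ?_
    rw [norm_mul, Complex.norm_real, Real.norm_of_nonneg (by positivity)]
    refine mul_le_mul_of_nonneg_left ((norm_sub_le _ _).trans ?_) (by positivity)
    linarith [norm_trigSum_cos_le Ω hlam a i hM (π * n / 2) (3 * π * n / 2) x,
      norm_trigSum_cos_le Ω hlam a i hM (π * n / 2) (π * n / 2) x]
  have he : trigSum Ω lam (derivCoeff lam i a) x =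
      Complex.I * ((4 * lam / π ^ 2 : ℝ) : ℂ) * trigSum Ω lam b x := by
    unfold trigSum
    rw [Finset.mul_sum]
    refine Finset.sum_congr rfl fun k _ => ?_
    have : (π : ℂ) ≠ 0 := by exact_mod_cast Real.pi_ne_zero
    simp only [derivCoeff, b]
    push_cast
    field_simp
  rw [he, norm_mul, norm_mul, Complex.norm_I, one_mul, Complex.norm_real,
    Real.norm_of_nonneg (by positivity)]
  refine (mul_le_mul_of_nonneg_left hb (by positivity)).trans (le_of_eq ?_)
  field_simp
  ring

theorem norm_trigSum_le (Ω : Finset (Fin 3 → ℝ)) (lam : ℕ) (a : (Fin 3 → ℝ) → ℂ)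
    (x : Fin 3 → ℝ) : ‖trigSum Ω lam a x‖ ≤ ∑ k ∈ Ω, ‖a k‖ := by
  refine norm_sum_le_of_le _ fun k _ => ?_
  rw [norm_mul, Complex.norm_exp_I_mul_ofReal, mul_one]

theorem integral_Icc_exp_int (m : ℤ) :
    ∫ t in Set.Icc 0 (2 * π), Complex.exp (Complex.I * m * t) =
      if m = 0 then ((2 * π : ℝ) : ℂ) else 0 := by
  rw [integral_Icc_eq_integral_Ioc, ← intervalIntegral.integral_of_le (by positivity)]
  split_ifs with h
  · simp [h]
  · have hm : Complex.I * (m : ℂ) ≠ 0 := by simp [h]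
    rw [integral_exp_mul_complex hm, div_eq_zero_iff]
    left
    have := Complex.exp_int_mul_two_pi_mul_I m
    rw [Complex.ofReal_zero, mul_zero, Complex.exp_zero, sub_eq_zero, ← this]
    congr 1
    push_cast
    ring

theorem integral_box3_exp_int (m : Fin 3 → ℤ) :
    ∫ x in box3, Complex.exp (Complex.I * ∑ i, (m i : ℂ) * (x i : ℂ)) =
      if m = 0 then ((2 * π : ℝ) : ℂ) ^ 3 else 0 := by
  have hbox : box3 = Set.univ.pi fun _ : Fin 3 => Set.Icc 0 (2 * π) := by
    rw [Set.pi_univ_Icc]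
    rfl
  rw [hbox, volume_pi, Measure.restrict_pi_pi]
  have h : ∀ x : Fin 3 → ℝ, Complex.exp (Complex.I * ∑ i, (m i : ℂ) * (x i : ℂ)) =
      ∏ i, Complex.exp (Complex.I * m i * x i) := by
    intro x
    rw [← Complex.exp_sum, Finset.mul_sum]
    simp only [mul_assoc]
  simp only [h]
  rw [integral_fintype_prod_eq_prod (fun i (t : ℝ) => Complex.exp (Complex.I * m i * t))]
  simp only [integral_Icc_exp_int]
  split_ifs with hm
  · simp [hm]
  · obtain ⟨i, hi⟩ := Function.ne_iff.1 hm
    exact Finset.prod_eq_zero (Finset.mem_univ i) (if_neg hi)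

/-- **Parseval's identity** for trigonometric sums with integer frequencies. -/
theorem integral_box3_trigSum_mul_conj {Ω : Finset (Fin 3 → ℝ)} {lam : ℕ} (hlam : 0 < lam)
    (hint : ∀ k ∈ Ω, ∀ i, ∃ m : ℤ, (lam : ℝ) * k i = (m : ℝ)) (a b : (Fin 3 → ℝ) → ℂ) :
    ∫ x in box3, trigSum Ω lam a x * starRingEnd ℂ (trigSum Ω lam b x) =
      ((2 * π : ℝ) : ℂ) ^ 3 * ∑ k ∈ Ω, a k * starRingEnd ℂ (b k) := by
  have hl : (lam : ℝ) ≠ 0 := by positivity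
  have hterm : ∀ k ∈ Ω, ∀ l ∈ Ω, ∫ x in box3,
      Complex.exp (Complex.I * Complex.ofReal ((lam : ℝ) * ∑ i, k i * x i)) *
        Complex.exp (-(Complex.I * Complex.ofReal ((lam : ℝ) * ∑ i, l i * x i))) =
      if k = l then ((2 * π : ℝ) : ℂ) ^ 3 else 0 := by
    intro k hk l hl'
    choose m hm using hint k hk
    choose n hn using hint l hl'
    have hkl : m - n = 0 ↔ k = l := by
      rw [sub_eq_zero, funext_iff, funext_iff]
      refine forall_congr' fun i => ?_
      rw [← mul_right_inj' hl, hm, hn, Int.cast_inj]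
    simp only [← hkl]
    rw [← integral_box3_exp_int]
    congr 1
    funext x
    rw [← Complex.exp_add, ← sub_eq_add_neg, ← mul_sub, ← Complex.ofReal_sub, Finset.mul_sum,
      Finset.mul_sum, ← Finset.sum_sub_distrib]
    push_cast
    congr 2
    refine Finset.sum_congr rfl fun i _ => ?_
    have h1 : (lam : ℂ) * k i = m i := by exact_mod_cast hm i
    have h2 : (lam : ℂ) * l i = n i := by exact_mod_cast hn i
    simp only [Pi.sub_apply, Int.cast_sub, ← h1, ← h2]
    ring
  have hcomp : IsCompact box3 := isCompact_Icc
  have hexpand : ∀ x, trigSum Ω lam a x * starRingEnd ℂ (trigSum Ω lam b x) =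
      ∑ k ∈ Ω, ∑ l ∈ Ω, a k * starRingEnd ℂ (b l) *
        (Complex.exp (Complex.I * Complex.ofReal ((lam : ℝ) * ∑ i, k i * x i)) *
        Complex.exp (-(Complex.I * Complex.ofReal ((lam : ℝ) * ∑ i, l i * x i)))) := by
    intro x
    rw [conj_trigSum, trigSum, Finset.sum_mul_sum]
    refine Finset.sum_congr rfl fun k _ => Finset.sum_congr rfl fun l _ => ?_
    ring
  have hi : ∀ k l : Fin 3 → ℝ, IntegrableOn (fun x : Fin 3 → ℝ => a k * starRingEnd ℂ (b l) *
        (Complex.exp (Complex.I * Complex.ofReal ((lam : ℝ) * ∑ i, k i * x i)) *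
        Complex.exp (-(Complex.I * Complex.ofReal ((lam : ℝ) * ∑ i, l i * x i))))) box3 :=
    fun k l => ContinuousOn.integrableOn_compact hcomp (by fun_prop)
  simp only [hexpand]
  rw [integral_finsetSum _ fun k _ => integrable_finsetSum _ fun l _ => hi k l, Finset.mul_sum]
  refine Finset.sum_congr rfl fun k hk => ?_
  rw [integral_finsetSum _ fun l _ => hi k l, Finset.sum_eq_single_of_mem k hk]
  · rw [integral_const_mul, hterm k hk k hk, if_pos rfl]
    ring
  · intro l hl' hne
    rw [integral_const_mul, hterm k hk l hl', if_neg hne.symm, mul_zero]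

theorem integral_box3_re_mul_re {Ω : Finset (Fin 3 → ℝ)} {lam : ℕ} (hlam : 0 < lam)
    (hΩ : ∀ k : Fin 3 → ℝ, k ∈ Ω ↔ -k ∈ Ω)
    (hint : ∀ k ∈ Ω, ∀ i, ∃ m : ℤ, (lam : ℝ) * k i = (m : ℝ)) {a b : (Fin 3 → ℝ) → ℂ}
    (ha : ∀ k ∈ Ω, a (-k) = starRingEnd ℂ (a k)) (hb : ∀ k ∈ Ω, b (-k) = starRingEnd ℂ (b k)) :
    (((∫ x in box3, (trigSum Ω lam a x).re * (trigSum Ω lam b x).re) : ℝ) : ℂ) =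
      ((2 * π : ℝ) : ℂ) ^ 3 * ∑ k ∈ Ω, a k * starRingEnd ℂ (b k) := by
  rw [← integral_box3_trigSum_mul_conj hlam hint, ← integral_complex_ofReal]
  congr 1
  funext x
  rw [Complex.conj_eq_iff_im.2 (trigSum_im_eq_zero lam hΩ hb x), Complex.ofReal_mul,
    Complex.conj_eq_iff_re.1 (Complex.conj_eq_iff_im.2 (trigSum_im_eq_zero lam hΩ ha x)),
    Complex.conj_eq_iff_re.1 (Complex.conj_eq_iff_im.2 (trigSum_im_eq_zero lam hΩ hb x))]

theorem contDiff_pd3 {V : (Fin 3 → ℝ) → ℝ} (hV : ContDiff ℝ (⊤ : ℕ∞) V) (i : Fin 3) :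
    ContDiff ℝ (⊤ : ℕ∞) (pd3 i V) :=
  (hV.fderiv_right (m := (⊤ : ℕ∞)) (by simp)).clm_apply contDiff_const

theorem pd3_pd3_comm {V : (Fin 3 → ℝ) → ℝ} (hV : ContDiff ℝ (⊤ : ℕ∞) V) (i j : Fin 3)
    (x : Fin 3 → ℝ) : pd3 i (pd3 j V) x = pd3 j (pd3 i V) x := by
  have hd : DifferentiableAt ℝ (fderiv ℝ V) x :=
    ((hV.fderiv_right (m := (⊤ : ℕ∞)) (by simp)).differentiable (by simp)).differentiableAt
  have h : ∀ i j : Fin 3, pd3 i (pd3 j V) x =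
      fderiv ℝ (fderiv ℝ V) x (Pi.single i 1) (Pi.single j 1) := by
    intro i j
    unfold pd3
    rw [fderiv_clm_apply hd (differentiableAt_const _)]
    simp
  rw [h, h]
  refine hV.contDiffAt.isSymmSndFDerivAt ?_ _ _
  rw [minSmoothness_of_isRCLikeNormedField]
  exact WithTop.coe_le_coe.2 (le_top (a := (2 : ℕ∞)))

theorem pd3_mul {f g : (Fin 3 → ℝ) → ℝ} (hf : ContDiff ℝ (⊤ : ℕ∞) f)
    (hg : ContDiff ℝ (⊤ : ℕ∞) g) (i : Fin 3) (x : Fin 3 → ℝ) :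
    pd3 i (fun y => f y * g y) x = pd3 i f x * g x + f x * pd3 i g x := by
  unfold pd3
  rw [fderiv_fun_mul (hf.differentiable (by simp) x) (hg.differentiable (by simp) x)]
  simp
  ring

theorem pd3_neg (f : (Fin 3 → ℝ) → ℝ) (i : Fin 3) (x : Fin 3 → ℝ) :
    pd3 i (fun y => -f y) x = -pd3 i f x := by
  simp [pd3, fderiv_fun_neg]

/-- A vector potential for `∇̄ · (∇V ⊗ ∇̄⊥V)` when `ΔV = -μV`. -/
def vecPotential (μ : ℝ) (V : (Fin 3 → ℝ) → ℝ) (x : Fin 3 → ℝ) : Fin 3 → ℝ :=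
  ![-(pd3 0 V x * pd3 2 V x), -(pd3 1 V x * pd3 2 V x),
    1 / 2 * (pd3 0 V x * pd3 0 V x + pd3 1 V x * pd3 1 V x - pd3 2 V x * pd3 2 V x +
      μ * (V x * V x))]

theorem contDiff_vecPotential (μ : ℝ) {V : (Fin 3 → ℝ) → ℝ} (hV : ContDiff ℝ (⊤ : ℕ∞) V) :
    ContDiff ℝ (⊤ : ℕ∞) (vecPotential μ V) := by
  have h := contDiff_pd3 hV
  refine contDiff_pi.2 fun i => ?_
  fin_cases i
  · exact ((h 0).mul (h 2)).neg
  · exact ((h 1).mul (h 2)).neg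
  · exact contDiff_const.mul (((((h 0).mul (h 0)).add ((h 1).mul (h 1))).sub
      ((h 2).mul (h 2))).add (contDiff_const.mul (hV.mul hV)))

theorem pd3_vecPotential_two (μ : ℝ) {V : (Fin 3 → ℝ) → ℝ} (hV : ContDiff ℝ (⊤ : ℕ∞) V)
    (i : Fin 3) (x : Fin 3 → ℝ) :
    pd3 i (fun y => vecPotential μ V y 2) x =
      pd3 0 V x * pd3 i (pd3 0 V) x + pd3 1 V x * pd3 i (pd3 1 V) x -
        pd3 2 V x * pd3 i (pd3 2 V) x + μ * (V x * pd3 i V x) := by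
  have hd : ∀ {f : (Fin 3 → ℝ) → ℝ}, ContDiff ℝ (⊤ : ℕ∞) f →
      HasFDerivAt f (fderiv ℝ f x) x := fun hf => (hf.differentiable (by simp) x).hasFDerivAt
  have h := fun j => hd (contDiff_pd3 hV j)
  have := (((((h 0).mul (h 0)).add ((h 1).mul (h 1))).sub ((h 2).mul (h 2))).add
    (((hd hV).mul (hd hV)).const_mul μ)).const_mul (1 / 2)
  have h2 : fderiv ℝ (fun y => vecPotential μ V y 2) x = _ := this.fderiv
  rw [pd3, h2]
  simp
  unfold pd3
  ring

theorem divbarRow_eq {V : (Fin 3 → ℝ) → ℝ} (hV : ContDiff ℝ (⊤ : ℕ∞) V) (x : Fin 3 → ℝ)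
    (i : Fin 3) : divbarRow V x i =
      pd3 0 V x * pd3 1 (pd3 i V) x - pd3 1 V x * pd3 0 (pd3 i V) x := by
  have h := contDiff_pd3 hV
  have g0 : (fun y => pd3 i V y * gperp V y 0) = fun y => -(pd3 i V y * pd3 1 V y) := by
    funext y
    simp [gperp]
  have g1 : (fun y => pd3 i V y * gperp V y 1) = fun y => pd3 i V y * pd3 0 V y := rfl
  rw [divbarRow, g0, g1, pd3_neg, pd3_mul (h i) (h 1), pd3_mul (h i) (h 0),
    pd3_pd3_comm hV 0 1 x]
  ring

theorem divbarRow_eq_curl3_vecPotential {μ : ℝ} {V : (Fin 3 → ℝ) → ℝ}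
    (hV : ContDiff ℝ (⊤ : ℕ∞) V) (hlap : ∀ x, ∑ i, pd3 i (pd3 i V) x = -μ * V x)
    (x : Fin 3 → ℝ) (i : Fin 3) :
    divbarRow V x i = curl3 (vecPotential μ V) x i := by
  have h := contDiff_pd3 hV
  have hl := hlap x
  rw [Fin.sum_univ_three] at hl
  have c01 := pd3_pd3_comm hV 0 1 x
  have c02 := pd3_pd3_comm hV 0 2 x
  have c12 := pd3_pd3_comm hV 1 2 x
  have q0 : (fun y => vecPotential μ V y 0) = fun y => -(pd3 0 V y * pd3 2 V y) := rfl
  have q1 : (fun y => vecPotential μ V y 1) = fun y => -(pd3 1 V y * pd3 2 V y) := rfl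
  rw [divbarRow_eq hV]
  unfold curl3
  rw [pd3_vecPotential_two μ hV, pd3_vecPotential_two μ hV, q0, q1]
  simp only [pd3_neg, pd3_mul (h 0) (h 2), pd3_mul (h 1) (h 2)]
  fin_cases i
  · simp
    linear_combination (-pd3 1 V x) * hl + pd3 2 V x * c12
  · simp
    linear_combination pd3 0 V x * hl - pd3 2 V x * c02
  · simp
    linear_combination pd3 2 V x * c01

theorem norm_vecPotential_le {lam G : ℝ} {V : (Fin 3 → ℝ) → ℝ} {x : Fin 3 → ℝ}
    (hg : ∀ i, |pd3 i V x| ≤ G) (hv : |lam * V x| ≤ 4 * G) :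
    ‖vecPotential (lam ^ 2) V x‖ ≤ 10 * G ^ 2 := by
  have hp : ∀ i j, |pd3 i V x * pd3 j V x| ≤ G ^ 2 := by
    intro i j
    rw [abs_mul, sq]
    exact mul_le_mul (hg i) (hg j) (abs_nonneg _) ((abs_nonneg _).trans (hg i))
  have hG := sq_nonneg G
  have hvv : lam ^ 2 * (V x * V x) ≤ 16 * G ^ 2 := by
    nlinarith [sq_le_sq' (abs_le.1 hv).1 (abs_le.1 hv).2]
  have hv0 : 0 ≤ lam ^ 2 * (V x * V x) := by nlinarith [sq_nonneg (lam * V x)]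
  refine (pi_norm_le_iff_of_nonneg (by positivity)).2 fun i => ?_
  rw [Real.norm_eq_abs]
  fin_cases i
  · simpa [vecPotential, abs_neg] using (hp 0 2).trans (by linarith)
  · simpa [vecPotential, abs_neg] using (hp 1 2).trans (by linarith)
  · change |1 / 2 * (pd3 0 V x * pd3 0 V x + pd3 1 V x * pd3 1 V x - pd3 2 V x * pd3 2 V x +
      lam ^ 2 * (V x * V x))| ≤ _
    have h0 := abs_le.1 (hp 0 0)
    have h1 := abs_le.1 (hp 1 1)
    have h2 := abs_le.1 (hp 2 2)
    rw [abs_le]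
    constructor <;> linarith

/-- **Stationary solutions.** For `V = Σ_{k∈Ω} λ⁻¹ c_k e^{iλk·x}` built from symmetric
families of unit frequencies: `V` is real-valued, is an eigenfunction of the Laplacian,
`∇̄ · (∇V ⊗ ∇̄⊥V)` is a curl with quantitative bounds, and the average of `∇V ⊗ ∇̄⊥V`
is `Σ_k |c_k|² k ⊗ k̄⊥`. -/
theorem stationary_solutions :
    ∃ C : ℝ, 0 < C ∧
      ∀ (Ω : Finset (Fin 3 → ℝ)) (c : (Fin 3 → ℝ) → ℂ) (lam : ℕ), 0 < lam →
        (∀ k ∈ Ω, (∑ i, (k i) ^ 2) = 1) →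
        (∀ k : Fin 3 → ℝ, k ∈ Ω ↔ -k ∈ Ω) →
        (∀ k ∈ Ω, ∀ i, ∃ m : ℤ, (lam : ℝ) * k i = (m : ℝ)) →
        (∀ k ∈ Ω, c (-k) = starRingEnd ℂ (c k)) →
        -- (i) V is real-valued
        (∀ x, (Vc Ω c lam x).im = 0) ∧
        -- (ii) ΔV = −λ² V
        (∀ x, (∑ i, pd3 i (fun y => pd3 i (Vr Ω c lam) y) x) =
          -((lam : ℝ)) ^ 2 * Vr Ω c lam x) ∧
        -- (iii) ∇̄ · (∇V ⊗ ∇̄⊥V) = curl Q with bounds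
        (∃ Q : (Fin 3 → ℝ) → Fin 3 → ℝ, ContDiff ℝ (⊤ : ℕ∞) Q ∧
          (∀ x i, divbarRow (Vr Ω c lam) x i = curl3 Q x i) ∧
          (∀ x, ‖Q x‖ ≤
            C * (⨆ y, ‖(fun i => pd3 i (Vr Ω c lam) y : Fin 3 → ℝ)‖) ^ 2) ∧
          (∀ x, ‖curl3 Q x‖ ≤
            C * (lam : ℝ) * (⨆ y, ‖(fun i => pd3 i (Vr Ω c lam) y : Fin 3 → ℝ)‖) ^ 2)) ∧
        -- (iv) the mean of ∇V ⊗ ∇̄⊥V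
        (∀ i j, (((2 * Real.pi) ^ 3 : ℝ)⁻¹ *
            ∫ x in box3, pd3 i (Vr Ω c lam) x * gperp (Vr Ω c lam) x j) =
          ∑ k ∈ Ω, Complex.normSq (c k) * (k i * kperp k j)) := by
  refine ⟨10, by norm_num, ?_⟩
  intro Ω c lam hlam hunit hΩ hint hc
  have hl : (0 : ℝ) < lam := by exact_mod_cast hlam
  have hlC : (lam : ℂ) ≠ 0 := by exact_mod_cast hlam.ne'
  set a : (Fin 3 → ℝ) → ℂ := fun k => (lam : ℂ)⁻¹ * c k with ha_def
  have ha : ∀ k ∈ Ω, a (-k) = starRingEnd ℂ (a k) := by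
    intro k hk
    simp [ha_def, hc k hk]
  have hVr : Vr Ω c lam = fun x => (trigSum Ω lam a x).re := rfl
  have hV : ContDiff ℝ (⊤ : ℕ∞) (Vr Ω c lam) := contDiff_re_trigSum Ω lam a
  have hd : ∀ i, pd3 i (Vr Ω c lam) = fun x => (trigSum Ω lam (derivCoeff lam i a) x).re :=
    pd3_re_trigSum Ω lam a
  have hdd : ∀ i j, pd3 i (pd3 j (Vr Ω c lam)) =
      fun x => (trigSum Ω lam (derivCoeff lam i (derivCoeff lam j a)) x).re := by
    intro i j
    rw [hd j, pd3_re_trigSum]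
  have hlap : ∀ x, ∑ i, pd3 i (pd3 i (Vr Ω c lam)) x = -(lam : ℝ) ^ 2 * Vr Ω c lam x := by
    intro x
    simp only [hdd]
    have h : ∑ i, trigSum Ω lam (derivCoeff lam i (derivCoeff lam i a)) x =
        ((-(lam : ℝ) ^ 2 : ℝ) : ℂ) * trigSum Ω lam a x := by
      unfold trigSum
      rw [Finset.sum_comm, Finset.mul_sum]
      refine Finset.sum_congr rfl fun k hk => ?_
      have hu : ∑ i, ((k i : ℝ) : ℂ) ^ 2 = 1 := by exact_mod_cast hunit k hk
      rw [← Finset.sum_mul, ← mul_assoc]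
      congr 1
      calc ∑ i, derivCoeff lam i (derivCoeff lam i a) k
          = ∑ i, (-(lam : ℂ) ^ 2 * a k) * ((k i : ℝ) : ℂ) ^ 2 := by
            refine Finset.sum_congr rfl fun i _ => ?_
            simp only [derivCoeff]
            push_cast
            linear_combination ((lam : ℂ) ^ 2 * (k i) ^ 2 * a k) * Complex.I_sq
        _ = _ := by
            rw [← Finset.mul_sum, hu]
            push_cast
            ring
    rw [← Complex.re_sum, h, Complex.re_ofReal_mul, hVr]
  set G : ℝ := ⨆ y, ‖(fun i => pd3 i (Vr Ω c lam) y : Fin 3 → ℝ)‖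
  have hbdd : BddAbove (Set.range fun y => ‖(fun i => pd3 i (Vr Ω c lam) y : Fin 3 → ℝ)‖) := by
    refine ⟨∑ i, ∑ k ∈ Ω, ‖derivCoeff lam i a k‖, ?_⟩
    rintro _ ⟨y, rfl⟩
    refine (pi_norm_le_iff_of_nonneg (by positivity)).2 fun i => ?_
    rw [hd, Real.norm_eq_abs]
    refine ((Complex.abs_re_le_norm _).trans (norm_trigSum_le _ _ _ _)).trans ?_
    exact Finset.single_le_sum (f := fun i => ∑ k ∈ Ω, ‖derivCoeff lam i a k‖)
      (fun i _ => by positivity) (Finset.mem_univ i)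
  have hg : ∀ i x, |pd3 i (Vr Ω c lam) x| ≤ G := fun i x =>
    (norm_le_pi_norm (fun i => pd3 i (Vr Ω c lam) x) i).trans (le_ciSup hbdd x)
  have hk1 : ∀ i, ∀ k ∈ Ω, |k i| ≤ 1 := by
    intro i k hk
    rw [← sq_le_one_iff_abs_le_one, ← hunit k hk]
    exact Finset.single_le_sum (f := fun i => k i ^ 2) (fun i _ => sq_nonneg _)
      (Finset.mem_univ i)
  have hh : ∀ i j x, |pd3 i (pd3 j (Vr Ω c lam)) x| ≤ 4 / 3 * lam * G := by
    intro i j x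
    rw [hdd]
    refine (Complex.abs_re_le_norm _).trans
      (norm_trigSum_derivCoeff_le Ω hlam _ i (hk1 i) (fun y => ?_) x)
    have him := trigSum_im_eq_zero lam hΩ (derivCoeff_neg lam j ha) y
    rw [← Complex.abs_re_eq_norm.2 him]
    simpa only [hd] using hg j y
  have hv : ∀ x, |lam * Vr Ω c lam x| ≤ 4 * G := by
    intro x
    have h := hlap x
    rw [Fin.sum_univ_three] at h
    have h0 := abs_le.1 (hh 0 0 x)
    have h1 := abs_le.1 (hh 1 1 x)
    have h2 := abs_le.1 (hh 2 2 x)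
    rw [abs_le]
    constructor <;> refine le_of_mul_le_mul_left ?_ hl <;> linarith
  have hcurl := divbarRow_eq_curl3_vecPotential hV hlap
  refine ⟨trigSum_im_eq_zero lam hΩ ha, hlap, ⟨vecPotential ((lam : ℝ) ^ 2) (Vr Ω c lam),
    contDiff_vecPotential _ hV, hcurl,
    fun x => norm_vecPotential_le (fun i => hg i x) (hv x), fun x => ?_⟩, fun i j => ?_⟩
  · refine (pi_norm_le_iff_of_nonneg (by positivity)).2 fun i => ?_
    rw [← hcurl, divbarRow_eq hV, Real.norm_eq_abs]
    have hG0 : 0 ≤ G := (abs_nonneg _).trans (hg 0 x)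
    have hp : ∀ j l, |pd3 j (Vr Ω c lam) x * pd3 l (pd3 i (Vr Ω c lam)) x| ≤
        G * (4 / 3 * lam * G) := by
      intro j l
      rw [abs_mul]
      exact mul_le_mul (hg j x) (hh l i x) (abs_nonneg _) hG0
    refine (abs_sub _ _).trans ((add_le_add (hp 0 1) (hp 1 0)).trans ?_)
    have : 0 ≤ lam * G ^ 2 := by positivity
    linarith
  · have hmean : ∀ i j, ((2 * π) ^ 3 : ℝ)⁻¹ *
        ∫ x in box3, pd3 i (Vr Ω c lam) x * pd3 j (Vr Ω c lam) x =
          ∑ k ∈ Ω, Complex.normSq (c k) * (k i * k j) := by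
      intro i j
      rw [inv_mul_eq_iff_eq_mul₀ (by positivity)]
      apply Complex.ofReal_injective
      rw [hd i, hd j, integral_box3_re_mul_re hlam hΩ hint (derivCoeff_neg lam i ha)
        (derivCoeff_neg lam j ha), Complex.ofReal_mul ((2 * π) ^ 3), Complex.ofReal_sum,
        Complex.ofReal_pow]
      congr 1
      refine Finset.sum_congr rfl fun k _ => ?_
      rw [Complex.ofReal_mul, ← Complex.mul_conj]
      simp only [derivCoeff, ha_def, map_mul, map_inv₀, Complex.conj_I, Complex.conj_ofReal,
        Complex.conj_natCast, Complex.ofReal_mul, Complex.ofReal_natCast]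
      field_simp
      rw [Complex.I_sq]
      ring
    fin_cases j
    · have h := hmean i 1
      simp only [gperp, kperp, Fin.zero_eta, Matrix.cons_val_zero, mul_neg, integral_neg,
        Finset.sum_neg_distrib, h]
    · exact hmean i 0
    · simp [gperp, kperp]

end
end

section
/- Let Ω ⊂ S² be a finite set with Ω = −Ω, let λ ∈ ℕ be such that λk ∈ ℤ³ for every k ∈ Ω, and let c_k ∈ ℂ (k ∈ Ω) satisfy c_k = conj(c_{−k}). Define V(x) := Σ_{k∈Ω} λ^{−1} c_k e^{iλ k·x}. Then the vector field ∇̄ · (∇V ⊗ ∇̄⊥V) is divergence-free on 𝕋³ (with the full three-dimensional divergence), i.e. ∇ · ( ∇̄ · (∇V ⊗ ∇̄⊥V) ) = 0 pointwise; equivalently, for every x ∈ 𝕋³, Σ_{k,k'∈Ω} c_k c_{k'} e^{iλ(k+k')·x} (k̄'⊥ · k)(k · (k+k')) = 0. -/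
open Real

noncomputable section

/-- Partial derivative of a (complex-valued) function in the `i`-th coordinate direction. -/
def pdC (i : Fin 3) (F : (Fin 3 → ℝ) → ℂ) (x : Fin 3 → ℝ) : ℂ :=
  fderiv ℝ F x (Pi.single i 1)

/-- The stratified velocity field `∇̄⊥V = (−∂_y V, ∂ₓ V, 0)`. -/
def gperpC (F : (Fin 3 → ℝ) → ℂ) (x : Fin 3 → ℝ) : Fin 3 → ℂ :=
  ![-(pdC 1 F x), pdC 0 F x, 0]

/-- The `i`-th row of `∇̄ · (∇V ⊗ ∇̄⊥V)` (horizontal divergence, row by row). -/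
def divbarRowC (F : (Fin 3 → ℝ) → ℂ) (x : Fin 3 → ℝ) (i : Fin 3) : ℂ :=
  pdC 0 (fun y => pdC i F y * gperpC F y 0) x +
    pdC 1 (fun y => pdC i F y * gperpC F y 1) x

/-- The plane wave `x ↦ e^{i l w·x}`. -/
def planeWave (l : ℕ) (w x : Fin 3 → ℝ) : ℂ :=
  Complex.exp (Complex.I * Complex.ofReal ((l : ℝ) * ∑ i, w i * x i))

lemma planeWave_mul (l : ℕ) (v w x : Fin 3 → ℝ) :
    planeWave l v x * planeWave l w x = planeWave l (v + w) x := by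
  simp only [planeWave, ← Complex.exp_add, Pi.add_apply, add_mul, Finset.sum_add_distrib]
  congr 1
  push_cast
  ring

lemma hasFDerivAt_planeWave (l : ℕ) (w x : Fin 3 → ℝ) :
    HasFDerivAt (planeWave l w)
      (planeWave l w x • (Complex.I • Complex.ofRealCLM.comp
        ((l : ℝ) • ∑ i, w i • ContinuousLinearMap.proj (R := ℝ) (φ := fun _ : Fin 3 => ℝ) i)))
      x := by
  have h : HasFDerivAt (fun y : Fin 3 → ℝ => ∑ i, w i * y i)
      (∑ i, w i • ContinuousLinearMap.proj (R := ℝ) (φ := fun _ : Fin 3 => ℝ) i) x :=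
    HasFDerivAt.fun_sum fun i _ => (hasFDerivAt_apply i x).const_mul (w i)
  exact ((Complex.ofRealCLM.hasFDerivAt.comp x (h.const_mul (l : ℝ))).const_mul
    Complex.I).cexp

lemma pdC_sum_planeWave {ι : Type*} (s : Finset ι) (a : ι → ℂ) (w : ι → Fin 3 → ℝ) (l : ℕ)
    (i : Fin 3) (x : Fin 3 → ℝ) :
    pdC i (fun y => ∑ p ∈ s, a p * planeWave l (w p) y) x =
      ∑ p ∈ s, (a p * (Complex.I * l * w p i)) * planeWave l (w p) x := by
  have h := HasFDerivAt.fun_sum (u := s) fun p _ =>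
    (hasFDerivAt_planeWave l (w p) x).const_mul (a p)
  rw [pdC, h.fderiv, sum_apply]
  refine Finset.sum_congr rfl fun p _ => ?_
  simp [Pi.single_apply]
  ring

lemma gperpC_sum_planeWave {ι : Type*} (s : Finset ι) (a : ι → ℂ) (w : ι → Fin 3 → ℝ) (l : ℕ)
    (j : Fin 3) (x : Fin 3 → ℝ) :
    gperpC (fun y => ∑ p ∈ s, a p * planeWave l (w p) y) x j =
      ∑ p ∈ s, (a p * (Complex.I * l * kperp (w p) j)) * planeWave l (w p) x := by
  fin_cases j <;> simp [gperpC, kperp, pdC_sum_planeWave]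

lemma sum_planeWave_mul_sum_planeWave (s : Finset (Fin 3 → ℝ)) (a b : (Fin 3 → ℝ) → ℂ) (l : ℕ)
    (x : Fin 3 → ℝ) :
    (∑ k ∈ s, a k * planeWave l k x) * (∑ k ∈ s, b k * planeWave l k x) =
      ∑ p ∈ s ×ˢ s, (a p.1 * b p.2) * planeWave l (p.1 + p.2) x := by
  rw [Finset.sum_mul_sum, ← Finset.sum_product']
  refine Finset.sum_congr rfl fun p _ => ?_
  rw [← planeWave_mul]
  ring

lemma divbarRowC_sum_planeWave (s : Finset (Fin 3 → ℝ)) (a : (Fin 3 → ℝ) → ℂ) (l : ℕ)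
    (i : Fin 3) (x : Fin 3 → ℝ) :
    divbarRowC (fun y => ∑ k ∈ s, a k * planeWave l k y) x i =
      ∑ p ∈ s ×ˢ s, (a p.1 * a p.2 * (Complex.I * l) ^ 3 *
        (p.1 i * ∑ j, kperp p.2 j * (p.1 j + p.2 j) : ℝ)) * planeWave l (p.1 + p.2) x := by
  simp only [divbarRowC, pdC_sum_planeWave, gperpC_sum_planeWave,
    sum_planeWave_mul_sum_planeWave]
  rw [← Finset.sum_add_distrib]
  refine Finset.sum_congr rfl fun p _ => ?_
  simp [Fin.sum_univ_three, kperp]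
  ring

lemma div_divbarRowC_sum_planeWave (s : Finset (Fin 3 → ℝ)) (a : (Fin 3 → ℝ) → ℂ) (l : ℕ)
    (x : Fin 3 → ℝ) :
    ∑ i, pdC i (fun y => divbarRowC (fun z => ∑ k ∈ s, a k * planeWave l k z) y i) x =
      ∑ k ∈ s, ∑ k' ∈ s, a k * a k' * (Complex.I * l) ^ 4 * planeWave l (k + k') x *
        ((∑ i, kperp k' i * k i) * (∑ i, k i * (k i + k' i)) : ℝ) := by
  simp only [divbarRowC_sum_planeWave, pdC_sum_planeWave]
  rw [Finset.sum_comm, Finset.sum_product]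
  refine Finset.sum_congr rfl fun k _ => Finset.sum_congr rfl fun k' _ => ?_
  simp [Fin.sum_univ_three, kperp]
  ring

lemma sum_sum_eq_zero_of_antisymm {ι : Type*} (s : Finset ι) (f : ι → ι → ℂ)
    (h : ∀ k ∈ s, ∀ k' ∈ s, f k k' = -f k' k) : ∑ k ∈ s, ∑ k' ∈ s, f k k' = 0 := by
  rw [← self_eq_neg]
  calc ∑ k ∈ s, ∑ k' ∈ s, f k k' = ∑ k ∈ s, ∑ k' ∈ s, -f k' k :=
        Finset.sum_congr rfl fun k hk => Finset.sum_congr rfl fun k' hk' => h k hk k' hk'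
    _ = -∑ k ∈ s, ∑ k' ∈ s, f k k' := by
        simp only [Finset.sum_neg_distrib]
        rw [Finset.sum_comm]

lemma kperp_mul_antisymm {k k' : Fin 3 → ℝ} (hk : ∑ i, k i ^ 2 = ∑ i, k' i ^ 2) :
    (∑ i, kperp k' i * k i) * (∑ i, k i * (k i + k' i)) =
      -((∑ i, kperp k i * k' i) * (∑ i, k' i * (k' i + k i))) := by
  simp [Fin.sum_univ_three, kperp] at hk ⊢
  linear_combination (k' 0 * k 1 - k' 1 * k 0) * hk

/-- **The key algebraic identity.** The vector field `∇̄ · (∇V ⊗ ∇̄⊥V)` is divergence-free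
(for the full three-dimensional divergence); equivalently, the quadratic exponential sum
`Σ_{k,k'} c_k c_{k'} e^{iλ(k+k')·x} (k̄'⊥·k)(k·(k+k')) ` vanishes identically. -/
theorem stationary_divergence_free
    (Ω : Finset (Fin 3 → ℝ)) (c : (Fin 3 → ℝ) → ℂ) (lam : ℕ)
    (hsphere : ∀ k ∈ Ω, (∑ i, (k i) ^ 2) = 1)
    (hsym : ∀ k : Fin 3 → ℝ, k ∈ Ω ↔ -k ∈ Ω)
    (hlat : ∀ k ∈ Ω, ∀ i, ∃ m : ℤ, (lam : ℝ) * k i = (m : ℝ))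
    (hc : ∀ k ∈ Ω, c (-k) = starRingEnd ℂ (c k)) :
    (∀ x : Fin 3 → ℝ,
      (∑ i, pdC i (fun y => divbarRowC (Vc Ω c lam) y i) x) = 0) ∧
    (∀ x : Fin 3 → ℝ,
      (∑ k ∈ Ω, ∑ k' ∈ Ω, c k * c k' *
        Complex.exp (Complex.I * Complex.ofReal ((lam : ℝ) * ∑ i, (k i + k' i) * x i)) *
        Complex.ofReal ((∑ i, kperp k' i * k i) * (∑ i, k i * (k i + k' i)))) = 0) := by
  have key (b : ℂ) (a : (Fin 3 → ℝ) → ℂ) (x : Fin 3 → ℝ) :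
      ∑ k ∈ Ω, ∑ k' ∈ Ω, a k * a k' * b * planeWave lam (k + k') x *
        ((∑ i, kperp k' i * k i) * (∑ i, k i * (k i + k' i)) : ℝ) = 0 := by
    refine sum_sum_eq_zero_of_antisymm Ω _ fun k hk k' hk' => ?_
    rw [kperp_mul_antisymm ((hsphere k hk).trans (hsphere k' hk').symm), add_comm k k']
    push_cast
    ring
  refine ⟨fun x => ?_, fun x => ?_⟩
  · exact (div_divbarRowC_sum_planeWave Ω _ lam x).trans (key _ _ x)
  · simpa only [mul_one, planeWave, Pi.add_apply] using key 1 c x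

end
end

section
/- For real parameters a > 1, b > 1, c > 5/2 and q ∈ ℕ define λ_q := a^{c b^q}, δ_q := a^{−b^q}, μ_{q+1} := δ_q^{1/4} δ_{q+1}^{1/4} λ_q^{1/2} λ_{q+1}^{1/2}, l_q := 2^{−(q+1)}, and ℓ := λ_q^{−3/4} λ_{q+1}^{−1/4}. Then for every c > 5/2 and every η ∈ (0,1) there exist b > 1, constants 0 < α < β < 1, and a₀ > 1 such that for all a ≥ a₀ and all q ∈ ℕ the following inequalities hold: (1) δ_q^{1/2} λ_q / μ_{q+1} ≤ λ_{q+1}^{−β}; (2) μ_{q+1} δ_{q+1}^{1/2} ≤ δ_{q+2} λ_{q+1}; (3) l_{q+1} δ_{q+1} / λ_{q+1} ≤ η δ_{q+2}; (4) δ_{q+1} δ_q^{1/2} λ_q ≤ δ_{q+2} δ_{q+1}^{1/2} λ_{q+1}; (5) λ_q ≤ λ_{q+1}^{1−β}; (6) λ_q^{1+α} ≤ λ_{q+1}^{1−α}; (7) ℓ λ_q ≤ 1. -/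
open Real

noncomputable section

/-- The frequency parameter `λ_q = a^{c b^q}`. -/
def lamP (a b c : ℝ) (q : ℕ) : ℝ := a ^ (c * b ^ q)

/-- The amplitude parameter `δ_q = a^{−b^q}`. -/
def delP (a b : ℝ) (q : ℕ) : ℝ := a ^ (-(b ^ q))

/-- The time-cutoff parameter `μ_{q+1} = δ_q^{1/4} δ_{q+1}^{1/4} λ_q^{1/2} λ_{q+1}^{1/2}`. -/
def muP (a b c : ℝ) (q : ℕ) : ℝ :=
  delP a b q ^ ((1 : ℝ) / 4) * delP a b (q + 1) ^ ((1 : ℝ) / 4) *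
    lamP a b c q ^ ((1 : ℝ) / 2) * lamP a b c (q + 1) ^ ((1 : ℝ) / 2)

/-- The spatial-support parameter `l_q = 2^{−(q+1)}`. -/
def lP (q : ℕ) : ℝ := 1 / 2 ^ (q + 1)

/-- The mollification scale `ℓ = λ_q^{−3/4} λ_{q+1}^{−1/4}`. -/
def ellP (a b c : ℝ) (q : ℕ) : ℝ :=
  lamP a b c q ^ (-(3 : ℝ) / 4) * lamP a b c (q + 1) ^ (-(1 : ℝ) / 4)

/-- **Parameter inequalities.** For every `c > 5/2` and `η ∈ (0,1)` there exist `b > 1`,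
`0 < α < β < 1` and `a₀ > 1` such that for all `a ≥ a₀` and all `q ∈ ℕ` the seven
inequalities of the convex integration scheme hold. -/
theorem parameter_inequalities (c : ℝ) (hc : 5 / 2 < c) (η : ℝ) (hη : η ∈ Set.Ioo (0 : ℝ) 1) :
    ∃ b : ℝ, 1 < b ∧
    ∃ α β : ℝ, 0 < α ∧ α < β ∧ β < 1 ∧
    ∃ a₀ : ℝ, 1 < a₀ ∧
      ∀ a : ℝ, a₀ ≤ a → ∀ q : ℕ,
        -- (1)
        delP a b q ^ ((1 : ℝ) / 2) * lamP a b c q / muP a b c q ≤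
          lamP a b c (q + 1) ^ (-β) ∧
        -- (2)
        muP a b c q * delP a b (q + 1) ^ ((1 : ℝ) / 2) ≤
          delP a b (q + 2) * lamP a b c (q + 1) ∧
        -- (3)
        lP (q + 1) * delP a b (q + 1) / lamP a b c (q + 1) ≤ η * delP a b (q + 2) ∧
        -- (4)
        delP a b (q + 1) * delP a b q ^ ((1 : ℝ) / 2) * lamP a b c q ≤
          delP a b (q + 2) * delP a b (q + 1) ^ ((1 : ℝ) / 2) * lamP a b c (q + 1) ∧
        -- (5)
        lamP a b c q ≤ lamP a b c (q + 1) ^ (1 - β) ∧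
        -- (6)
        lamP a b c q ^ (1 + α) ≤ lamP a b c (q + 1) ^ (1 - α) ∧
        -- (7)
        ellP a b c q * lamP a b c q ≤ 1 := by
  obtain ⟨hη0, hη1⟩ := hη
  obtain ⟨b, hbdef⟩ : ∃ b : ℝ, b = c / 2 - 1 / 4 := ⟨_, rfl⟩
  have hb : 1 < b := by linarith
  have hb0 : 0 < b := by linarith
  have hcb : c = 2 * b + 1 / 2 := by linarith
  obtain ⟨β, hβ⟩ : ∃ β : ℝ, β = (b - 1) / (4 * b) := ⟨_, rfl⟩
  have hβb : β * b = (b - 1) / 4 := by rw [hβ]; field_simp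
  have hβ0 : 0 < β := hβ ▸ div_pos (by linarith) (by linarith)
  have hβ1 : β < 1 := by nlinarith
  refine ⟨b, hb, β / 2, β, by linarith, by linarith, hβ1, 1 / η, one_lt_one_div hη0 hη1, ?_⟩
  intro a ha q
  have ha1 : 1 < a := (one_lt_one_div hη0 hη1).trans_le ha
  have ha0 : 0 < a := by linarith
  have hB : 1 ≤ b ^ q := one_le_pow₀ hb.le
  have h1 : b ^ (q + 1) = b * b ^ q := pow_succ' b q
  have h2 : b ^ (q + 2) = b ^ 2 * b ^ q := by ring
  simp only [lamP, delP, muP, ellP, h1, h2]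
  generalize b ^ q = B at hB
  have hB0 : 0 < B := by linarith
  have exponent_le {x y u : ℝ} (hu : u ≤ 0) (h : x - y = B * u) : x ≤ y := by nlinarith
  refine ⟨?_, ?_, ?_, ?_, ?_, ?_, ?_⟩
  · simp only [← rpow_mul ha0.le, ← rpow_add ha0, ← rpow_sub ha0]
    refine rpow_le_rpow_of_exponent_le ha1.le (exponent_le
      (u := (b - 1) / 4 - c * (b - 1) / 2 + c * (β * b)) ?_ (by ring))
    rw [hβb]; nlinarith
  · simp only [← rpow_mul ha0.le, ← rpow_add ha0]
    refine rpow_le_rpow_of_exponent_le ha1.le (exponent_le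
      (u := (b - 1) * (b + 1 / 4 - c / 2)) ?_ (by ring))
    nlinarith
  · have hl0 : 0 < lP (q + 1) := by unfold lP; positivity
    have hl1 : lP (q + 1) ≤ 1 := by
      unfold lP
      exact div_le_one_of_le₀ (one_le_pow₀ (by norm_num)) (by positivity)
    have hη' : a ^ (-1 : ℝ) ≤ η := by
      rw [rpow_neg_one]
      exact inv_le_of_inv_le₀ hη0 (by simpa using ha)
    calc lP (q + 1) * a ^ (-(b * B)) / a ^ (c * (b * B))
        = lP (q + 1) * a ^ (-(b * B) - c * (b * B)) := by rw [rpow_sub ha0, mul_div_assoc]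
      _ ≤ 1 * a ^ (-(b * B) - c * (b * B)) := by gcongr
      _ ≤ a ^ (-1 + -(b ^ 2 * B)) := by
        rw [one_mul]
        refine rpow_le_rpow_of_exponent_le ha1.le ?_
        have h : -(b * B) - c * (b * B) - -(b ^ 2 * B) ≤ -B :=
          exponent_le (u := b ^ 2 - b - c * b + 1) (by subst hcb; nlinarith) (by ring)
        linarith
      _ = a ^ (-1 : ℝ) * a ^ (-(b ^ 2 * B)) := rpow_add ha0 _ _
      _ ≤ η * a ^ (-(b ^ 2 * B)) := by gcongr
  · simp only [← rpow_mul ha0.le, ← rpow_add ha0]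
    refine rpow_le_rpow_of_exponent_le ha1.le (exponent_le
      (u := (b - 1) * (b + 1 / 2 - c)) ?_ (by ring))
    nlinarith
  · simp only [← rpow_mul ha0.le]
    refine rpow_le_rpow_of_exponent_le ha1.le (exponent_le
      (u := c * (1 - b + β * b)) ?_ (by ring))
    rw [hβb]; nlinarith
  · simp only [← rpow_mul ha0.le]
    refine rpow_le_rpow_of_exponent_le ha1.le (exponent_le
      (u := c * (1 - b + β / 2 + β * b / 2)) ?_ (by ring))
    have : β ≤ β * b := by nlinarith
    nlinarith
  · simp only [← rpow_mul ha0.le, ← rpow_add ha0]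
    refine rpow_le_one_of_one_le_of_nonpos ha1.le (exponent_le
      (u := c * (1 - b) / 4) ?_ (by ring))
    nlinarith

end
end
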